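/- For every ε ∈ (0, 1/2) there exist constants c > 0 and C > 0 such that for every n ≥ 1, every t ≥ 0, and every ξ ∈ ℝⁿ with |ξ| ≥ ε, one has |K̂(t,ξ)| ≤ C ⟨ξ⟩^{−1} e^{−ct}. -/

import Mathlib

open MeasureTheory Real FourierTransform Filter
open scoped ENNReal

noncomputable section

abbrev Rn (n : ℕ) : Type := EuclideanSpace ℝ (Fin n)

/-- Fourier image of the damped wave kernel. -/
def Khat {n : ℕ} (t : ℝ) (ξ : Rn n) : ℝ :=
  if ‖ξ‖ < 1/2 then
    Real.exp (-t/2) * Real.sinh (t * Real.sqrt (1/4 - ‖ξ‖^2)) / Real.sqrt (1/4 - ‖ξ‖^2)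
  else if ‖ξ‖ = 1/2 then t * Real.exp (-t/2)
  else Real.exp (-t/2) * Real.sin (t * Real.sqrt (‖ξ‖^2 - 1/4)) / Real.sqrt (‖ξ‖^2 - 1/4)

/-- Time derivative of the kernel. -/
def KhatDt {n : ℕ} (t : ℝ) (ξ : Rn n) : ℝ := deriv (fun s => Khat s ξ) t

/-- Riesz potential `I_γ`. -/
def riesz (n : ℕ) (γ : ℝ) (f : Rn n → ℝ) : Rn n → ℝ :=
  if γ = 0 then f
  else fun x =>
    (Real.Gamma (((n : ℝ) - γ)/2) / (2 ^ γ * Real.pi ^ ((n : ℝ)/2) * Real.Gamma (γ/2))) *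
      ∫ y : Rn n, f y * ‖x - y‖ ^ (-((n : ℝ) - γ))

/-- `g` represents the Fourier transform of `f` in the tempered-distribution sense. -/
def HasFourier {n : ℕ} (f g : Rn n → ℂ) : Prop :=
  ∀ ψ : SchwartzMap (Rn n) ℂ,
    ∫ x : Rn n, f x * 𝓕 (fun y => ψ y) x = ∫ ξ : Rn n, g ξ * ψ ξ

/-- The Laplacian (sum of repeated coordinate second derivatives). -/
def lap {n : ℕ} (f : Rn n → ℝ) (x : Rn n) : ℝ :=
  ∑ i : Fin n,
    fderiv ℝ (fun y => fderiv ℝ f y (EuclideanSpace.single i 1)) x (EuclideanSpace.single i 1)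

lemma Real.sinh_le_mul_exp (x : ℝ) : Real.sinh x ≤ x * Real.exp x := by
  have h : Real.exp x * (1 - 2 * x) ≤ Real.exp (-x) := by
    have h1 := Real.add_one_le_exp (-(2 * x))
    have h2 : Real.exp (-x) = Real.exp x * Real.exp (-(2 * x)) := by
      rw [← Real.exp_add]; ring_nf
    rw [h2]
    exact mul_le_mul_of_nonneg_left (by linarith) (Real.exp_pos x).le
  rw [Real.sinh_eq]
  linarith

/-- Away from zero frequency, the kernel decays exponentially in time. -/
lemma abs_Khat_le_mul_exp {n : ℕ} {ε t : ℝ} (hε : 0 < ε) (hε' : ε < 1/2) (ht : 0 ≤ t)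
    {ξ : Rn n} (hξ : ε ≤ ‖ξ‖) : |Khat t ξ| ≤ t * Real.exp (-(ε^2 * t)) := by
  have hexp : Real.exp (-t/2) ≤ Real.exp (-(ε^2 * t)) := by
    apply Real.exp_le_exp.2
    have : ε^2 ≤ 1/2 := by nlinarith
    nlinarith
  unfold Khat
  split_ifs with h₁ h₂
  · set s := Real.sqrt (1/4 - ‖ξ‖^2) with hs
    have hs0 : 0 < s := Real.sqrt_pos.2 (by nlinarith [norm_nonneg ξ])
    have hs1 : s ≤ 1/2 - ε^2 := by
      apply Real.sqrt_le_iff.2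
      constructor <;> nlinarith [sq_nonneg (ε^2)]
    have hts : 0 ≤ t * s := by positivity
    rw [abs_of_nonneg (div_nonneg
      (mul_nonneg (Real.exp_pos _).le (Real.sinh_nonneg_iff.2 hts)) hs0.le), div_le_iff₀ hs0]
    calc Real.exp (-t/2) * Real.sinh (t * s)
        ≤ Real.exp (-t/2) * (t * s * Real.exp (t * s)) := by
          gcongr
          exact Real.sinh_le_mul_exp _
      _ = t * Real.exp (-t/2 + t * s) * s := by rw [Real.exp_add]; ring
      _ ≤ t * Real.exp (-(ε^2 * t)) * s := by
          gcongr
          nlinarith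
  · rw [abs_of_nonneg (by positivity)]
    gcongr
  · have hs0 : 0 < Real.sqrt (‖ξ‖^2 - 1/4) := by
      have : 1/2 < ‖ξ‖ := lt_of_le_of_ne (not_lt.1 h₁) (Ne.symm h₂)
      exact Real.sqrt_pos.2 (by nlinarith)
    rw [abs_div, abs_mul, abs_of_pos hs0, Real.abs_exp, div_le_iff₀ hs0]
    calc _ ≤ Real.exp (-(ε^2 * t)) * |t * Real.sqrt (‖ξ‖^2 - 1/4)| :=
          mul_le_mul hexp Real.abs_sin_le_abs (abs_nonneg _) (Real.exp_pos _).le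
      _ = _ := by rw [abs_of_nonneg (by positivity)]; ring

/-- At high frequency, the kernel gains one derivative. -/
lemma abs_Khat_le_of_one_le_norm {n : ℕ} (t : ℝ) {ξ : Rn n} (hξ : 1 ≤ ‖ξ‖) :
    |Khat t ξ| ≤ 2 * (Real.sqrt (1 + ‖ξ‖^2))⁻¹ * Real.exp (-t/2) := by
  have hle : Real.sqrt (1 + ‖ξ‖^2) ≤ 2 * Real.sqrt (‖ξ‖^2 - 1/4) := by
    apply Real.sqrt_le_iff.2
    refine ⟨by positivity, ?_⟩
    rw [mul_pow, Real.sq_sqrt (by nlinarith)]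
    nlinarith
  have hp : 0 < Real.sqrt (1 + ‖ξ‖^2) := by positivity
  have hs0 : 0 < Real.sqrt (‖ξ‖^2 - 1/4) := by linarith
  rw [Khat, if_neg (by linarith), if_neg (by linarith), abs_div, abs_mul, abs_of_pos hs0,
    Real.abs_exp]
  calc _ ≤ Real.exp (-t/2) * 1 / Real.sqrt (‖ξ‖^2 - 1/4) := by
        gcongr
        exact Real.abs_sin_le_one _
    _ ≤ Real.exp (-t/2) * 1 / (Real.sqrt (1 + ‖ξ‖^2) / 2) := by
        gcongr
        linarith
    _ = _ := by field_simp

theorem stmt_10 :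
    ∀ ε ∈ Set.Ioo (0:ℝ) (1/2), ∃ c > (0:ℝ), ∃ C > (0:ℝ),
      ∀ (n : ℕ), 1 ≤ n → ∀ t : ℝ, 0 ≤ t → ∀ ξ : Rn n, ε ≤ ‖ξ‖ →
        |Khat t ξ| ≤ C * (1 + ‖ξ‖^2) ^ (-(1:ℝ)/2) * Real.exp (-(c*t)) := by
  rintro ε ⟨hε, hε'⟩
  refine ⟨ε^2/2, by positivity, 4/ε^2 + 2, by positivity, fun n _ t ht ξ hξ => ?_⟩
  have hrpow : (1 + ‖ξ‖^2) ^ (-(1:ℝ)/2) = (Real.sqrt (1 + ‖ξ‖^2))⁻¹ := by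
    rw [Real.sqrt_eq_rpow, ← Real.rpow_neg (by positivity)]
    norm_num
  rw [hrpow]
  have hp : 0 < Real.sqrt (1 + ‖ξ‖^2) := by positivity
  rcases le_total 1 ‖ξ‖ with h1 | h1
  · refine (abs_Khat_le_of_one_le_norm t h1).trans ?_
    gcongr
    · linarith [show 0 < 4/ε^2 by positivity]
    · have : ε^2 ≤ 1 := by nlinarith
      nlinarith
  · refine (abs_Khat_le_mul_exp hε hε' ht hξ).trans ?_
    have hsqrt : Real.sqrt (1 + ‖ξ‖^2) ≤ 2 :=
      Real.sqrt_le_iff.2 ⟨by norm_num, by nlinarith [norm_nonneg ξ]⟩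
    have hlin : t ≤ 2/ε^2 * Real.exp (ε^2/2*t) := by
      have := Real.add_one_le_exp (ε^2/2*t)
      rw [div_mul_eq_mul_div, le_div_iff₀ (by positivity)]
      linarith
    calc t * Real.exp (-(ε^2 * t))
        ≤ 2/ε^2 * Real.exp (ε^2/2*t) * Real.exp (-(ε^2 * t)) := by gcongr
      _ = 4/ε^2 * 2⁻¹ * Real.exp (-(ε^2/2*t)) := by
          rw [mul_assoc, ← Real.exp_add]; ring_nf
      _ ≤ (4/ε^2 + 2) * (Real.sqrt (1 + ‖ξ‖^2))⁻¹ * Real.exp (-(ε^2/2*t)) := by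
          gcongr
          linarith

end
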